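/- Let $M \subseteq Y$ be an extension of $R$-modules. (a) If $M$ is totally separated and $M \subseteq Y$ is strictly pure-essential, then $Y$ is totally separated. (b) If $Y$ is totally separated and $M$ is pure and dense in $Y$, then $M \subseteq Y$ is strictly pure-essential. -/

import Mathlib

/- Throughout, `(R, 𝔪)` is a commutative noetherian local ring and all modules are `R`-modules.
`AdicCompletion (maximalIdeal R) M` is the `𝔪`-adic completion `lim M/𝔪^n M` and
`IsHausdorff (maximalIdeal R) M` says that `M` is (`𝔪`-adically) separated. -/

open TensorProduct IsLocalRing

universe u

section Definitions

variable (R : Type u) [CommRing R]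

/-- A linear map is a *pure monomorphism* if it is injective and remains injective after
tensoring with an arbitrary module. -/
def IsPureMono {M N : Type u} [AddCommGroup M] [Module R M] [AddCommGroup N] [Module R N]
    (f : M →ₗ[R] N) : Prop :=
  Function.Injective f ∧
    ∀ (X : Type u) [AddCommGroup X] [Module R X], Function.Injective (LinearMap.lTensor X f)

/-- A module `N` is *pure-injective* if every pure monomorphism out of `N` splits. -/
def IsPureInjective (N : Type u) [AddCommGroup N] [Module R N] : Prop :=
  ∀ (Y : Type u) [AddCommGroup Y] [Module R Y] (f : N →ₗ[R] Y),
    IsPureMono R f → ∃ g : Y →ₗ[R] N, g ∘ₗ f = LinearMap.id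

/-- A submodule `A ⊆ B` is *pure* if its inclusion is a pure monomorphism. -/
def IsPureSubmodule {B : Type u} [AddCommGroup B] [Module R B] (A : Submodule R B) : Prop :=
  IsPureMono R A.subtype

/-- An extension `A ⊆ B` is *pure-essential* if `A` is pure in `B` and for every submodule
`X ⊆ B` with `X ⊓ A = 0` such that `(X ⊕ A)/X` is pure in `B/X`, one has `X = 0`. -/
def IsPureEssential {B : Type u} [AddCommGroup B] [Module R B] (A : Submodule R B) : Prop :=
  IsPureSubmodule R A ∧
    ∀ X : Submodule R B, X ⊓ A = ⊥ → IsPureMono R (X.mkQ ∘ₗ A.subtype) → X = ⊥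

/-- An extension `A ⊆ B` is *strictly pure-essential* if it is pure-essential and for every
extension `B ⊆ Y` in which `A` is pure in `Y`, also `B` is pure in `Y`. -/
def IsStrictlyPureEssential {B : Type u} [AddCommGroup B] [Module R B] (A : Submodule R B) :
    Prop :=
  IsPureEssential R A ∧
    ∀ (Y : Type u) [AddCommGroup Y] [Module R Y] (g : B →ₗ[R] Y),
      Function.Injective g → IsPureMono R (g ∘ₗ A.subtype) → IsPureMono R g

/-- A module `M` over a local ring is *totally separated* if `X ⊗[R] M` is `𝔪`-adically
separated for every finitely generated `R`-module `X`. -/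
def IsTotallySeparatedModule [IsLocalRing R] (M : Type u) [AddCommGroup M] [Module R M] :
    Prop :=
  ∀ (X : Type u) [AddCommGroup X] [Module R X] [Module.Finite R X],
    IsHausdorff (maximalIdeal R) (X ⊗[R] M)

end Definitions

section Purity

variable {R : Type u} [CommRing R]

lemma IsPureMono.of_forall_lTensor {A B : Type u} [AddCommGroup A] [Module R A] [AddCommGroup B]
    [Module R B] {f : A →ₗ[R] B}
    (h : ∀ (X : Type u) [AddCommGroup X] [Module R X], Function.Injective (f.lTensor X)) :
    IsPureMono R f := by
  refine ⟨(injective_iff_map_eq_zero f).mpr fun a ha => ?_, h⟩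
  have h1 : (1 : R) ⊗ₜ[R] a = 0 := h R (by simp [ha])
  simpa using congrArg (TensorProduct.lid R A) h1

/-- Purity can be tested on finitely generated modules. -/
lemma IsPureMono.of_forall_finite {A B : Type u} [AddCommGroup A] [Module R A] [AddCommGroup B]
    [Module R B] {f : A →ₗ[R] B}
    (h : ∀ (X : Type u) [AddCommGroup X] [Module R X] [Module.Finite R X],
      Function.Injective (f.lTensor X)) :
    IsPureMono R f := by
  refine .of_forall_lTensor fun X _ _ => (injective_iff_map_eq_zero _).mpr fun t ht => ?_
  obtain ⟨P, hP, hPt⟩ := exists_finite_submodule_left_of_setFinite {t} (Set.finite_singleton t)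
  obtain ⟨t', rfl⟩ := hPt rfl
  have h0 : LinearMap.rTensor B P.subtype (f.lTensor P t') = 0 := by
    rw [← ht, ← LinearMap.comp_apply, ← LinearMap.comp_apply, LinearMap.lTensor_comp_rTensor,
      LinearMap.rTensor_comp_lTensor]
  obtain ⟨Q, hPQ, hQ, h1⟩ := TensorProduct.eq_zero_of_fg_of_subtype_eq_zero
    (Module.Finite.iff_fg.mp hP) h0
  have : Module.Finite R Q := Module.Finite.iff_fg.mpr hQ
  have h2 : LinearMap.rTensor A (Submodule.inclusion hPQ) t' = 0 := by
    apply (injective_iff_map_eq_zero _).mp (h Q)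
    rw [← h1, ← LinearMap.comp_apply, ← LinearMap.comp_apply, LinearMap.lTensor_comp_rTensor,
      LinearMap.rTensor_comp_lTensor]
  rw [← Submodule.subtype_comp_inclusion _ _ hPQ, LinearMap.rTensor_comp, LinearMap.comp_apply, h2,
    map_zero]

lemma IsPureMono.of_comp {A B C : Type u} [AddCommGroup A] [Module R A] [AddCommGroup B]
    [Module R B] [AddCommGroup C] [Module R C] {f : A →ₗ[R] B} {g : B →ₗ[R] C}
    (h : IsPureMono R (g ∘ₗ f)) : IsPureMono R f := by
  refine .of_forall_lTensor fun X _ _ => ?_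
  have := h.2 X
  rw [LinearMap.lTensor_comp] at this
  exact Function.Injective.of_comp this

lemma IsPureMono.lTensor {A B : Type u} [AddCommGroup A] [Module R A] [AddCommGroup B]
    [Module R B] {f : A →ₗ[R] B} (h : IsPureMono R f) (X : Type u) [AddCommGroup X]
    [Module R X] : IsPureMono R (f.lTensor X) := by
  refine .of_forall_lTensor fun Z _ _ => (injective_iff_map_eq_zero _).mpr fun t ht => ?_
  have hc : f.lTensor (Z ⊗[R] X) ∘ₗ (TensorProduct.assoc R Z X A).symm.toLinearMap =
      (TensorProduct.assoc R Z X B).symm.toLinearMap ∘ₗ (f.lTensor X).lTensor Z := by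
    ext; simp
  have h1 := LinearMap.congr_fun hc t
  simp only [LinearMap.comp_apply, ht, map_zero] at h1
  simpa using (injective_iff_map_eq_zero _).mp (h.2 (Z ⊗[R] X)) _ h1

lemma IsPureMono.mem_smul_top {A B : Type u} [AddCommGroup A] [Module R A] [AddCommGroup B]
    [Module R B] {f : A →ₗ[R] B} (h : IsPureMono R f) (I : Ideal R) {a : A}
    (ha : f a ∈ I • (⊤ : Submodule R B)) : a ∈ I • (⊤ : Submodule R A) := by
  rw [← Submodule.Quotient.mk_eq_zero] at ha ⊢
  have h1 : (1 : R ⧸ I) ⊗ₜ[R] f a = 0 := by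
    rw [← TensorProduct.quotTensorEquivQuotSMul_symm_mk, ha, map_zero]
  have h2 : (1 : R ⧸ I) ⊗ₜ[R] a = 0 := h.2 (R ⧸ I) (by simp [h1])
  rw [← TensorProduct.quotTensorEquivQuotSMul_mk_one_tmul, h2, map_zero]

end Purity

section Density

variable {R : Type*} [CommRing R]

lemma Submodule.sup_pow_smul_top_eq_top {T : Type*} [AddCommGroup T] [Module R T] {I : Ideal R}
    {P : Submodule R T} (h : P ⊔ I • ⊤ = ⊤) (n : ℕ) : P ⊔ I ^ n • ⊤ = ⊤ := by
  induction n with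
  | zero => simp
  | succ n ih =>
    have hle : I ^ n • ⊤ ≤ P ⊔ I ^ (n + 1) • (⊤ : Submodule R T) := by
      calc I ^ n • ⊤ = I ^ n • (P ⊔ I • ⊤) := by rw [h]
        _ = I ^ n • P ⊔ I ^ (n + 1) • ⊤ := by rw [Submodule.smul_sup, pow_succ, Submodule.mul_smul]
        _ ≤ P ⊔ I ^ (n + 1) • ⊤ := sup_le_sup_right Submodule.smul_le_right _
    exact top_le_iff.mp (ih.ge.trans (sup_le le_sup_left hle))

lemma lTensor_range_sup_smul_top {X A B : Type*} [AddCommGroup X] [Module R X] [AddCommGroup A]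
    [Module R A] [AddCommGroup B] [Module R B] {I : Ideal R} {f : A →ₗ[R] B}
    (h : f.range ⊔ I • ⊤ = ⊤) : (f.lTensor X).range ⊔ I • ⊤ = ⊤ := by
  rw [eq_top_iff]
  rintro t -
  induction t with
  | zero => exact zero_mem _
  | add a b ha hb => exact add_mem ha hb
  | tmul x b =>
    suffices hle : f.range ⊔ I • ⊤ ≤ ((f.lTensor X).range ⊔ I • ⊤).comap (TensorProduct.mk R X B x)
      from hle (by rw [h]; trivial)
    refine sup_le ?_ ?_
    · rintro _ ⟨a, rfl⟩
      exact Submodule.mem_sup_left ⟨x ⊗ₜ a, by simp⟩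
    · rw [← Submodule.map_le_iff_le_comap, Submodule.map_smul'']
      exact (smul_mono_right _ le_top).trans le_sup_right

end Density

/-- A map out of a totally separated module is pure if its restriction to a dense submodule is. -/
lemma IsTotallySeparatedModule.isPureMono_of_dense {R : Type u} [CommRing R] [IsLocalRing R]
    {M Y Z : Type u} [AddCommGroup M] [Module R M] [AddCommGroup Y] [Module R Y] [AddCommGroup Z]
    [Module R Z] (hY : IsTotallySeparatedModule R Y) {f : M →ₗ[R] Y} {g : Y →ₗ[R] Z}
    (hf : f.range ⊔ maximalIdeal R • ⊤ = ⊤) (h : IsPureMono R (g ∘ₗ f)) : IsPureMono R g := by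
  refine .of_forall_finite fun X _ _ _ => (injective_iff_map_eq_zero _).mpr fun t ht => ?_
  refine (hY X).haus t fun n => ?_
  rw [SModEq.zero]
  have htop : t ∈ (f.lTensor X).range ⊔ maximalIdeal R ^ n • ⊤ := by
    rw [Submodule.sup_pow_smul_top_eq_top (lTensor_range_sup_smul_top hf)]
    trivial
  obtain ⟨_, ⟨s, rfl⟩, v, hv, rfl⟩ := Submodule.mem_sup.mp htop
  refine add_mem ?_ hv
  have hs : (g ∘ₗ f).lTensor X s ∈ maximalIdeal R ^ n • (⊤ : Submodule R (X ⊗[R] Z)) := by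
    rw [LinearMap.lTensor_comp, LinearMap.comp_apply, eq_neg_of_add_eq_zero_left
      ((map_add (g.lTensor X) _ _).symm.trans ht)]
    exact neg_mem (Submodule.smul_top_le_comap_smul_top _ (g.lTensor X) hv)
  exact Submodule.smul_top_le_comap_smul_top _ (f.lTensor X) ((h.lTensor X).mem_smul_top _ hs)

section Products

variable {R : Type*} [CommRing R]

lemma exists_eq_sum_tmul {X N ι : Type*} [Fintype ι] [AddCommGroup X] [Module R X]
    [AddCommGroup N] [Module R N] {x : ι → X} (hx : Submodule.span R (Set.range x) = ⊤)
    (t : X ⊗[R] N) : ∃ f : ι → N, t = ∑ i, x i ⊗ₜ[R] f i := by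
  induction t with
  | zero => exact ⟨0, by simp⟩
  | add a b ha hb =>
    obtain ⟨f, rfl⟩ := ha
    obtain ⟨g, rfl⟩ := hb
    exact ⟨f + g, by simp [TensorProduct.tmul_add, Finset.sum_add_distrib]⟩
  | tmul y n =>
    obtain ⟨c, rfl⟩ :=
      (Submodule.mem_span_range_iff_exists_fun R).mp (hx ▸ Submodule.mem_top (x := y))
    exact ⟨fun i => c i • n, by simp [TensorProduct.sum_tmul, TensorProduct.smul_tmul]⟩

/-- Tensoring with a finitely generated module over a noetherian ring commutes with products:
the injectivity half. -/
lemma eq_zero_of_forall_lTensor_proj_eq_zero [IsNoetherianRing R] {X κ : Type*} {N : κ → Type*}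
    [AddCommGroup X] [Module R X] [Module.Finite R X] [∀ k, AddCommGroup (N k)]
    [∀ k, Module R (N k)] (t : X ⊗[R] (∀ k, N k))
    (ht : ∀ k, (LinearMap.proj k : (∀ k, N k) →ₗ[R] N k).lTensor X t = 0) : t = 0 := by
  obtain ⟨d, x, hx⟩ := Module.Finite.exists_fin (R := R) (M := X)
  obtain ⟨f, rfl⟩ := exists_eq_sum_tmul hx t
  obtain ⟨s, r, hr⟩ := Submodule.fg_iff_exists_fin_generating_family.mp
    (IsNoetherian.noetherian (LinearMap.ker (Fintype.linearCombination R x)))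
  have hrel (l : Fin s) : ∑ i, r l i • x i = 0 := by
    have : r l ∈ LinearMap.ker (Fintype.linearCombination R x) :=
      hr ▸ Submodule.subset_span (Set.mem_range_self l)
    simpa [Fintype.linearCombination_apply] using this
  have key (k : κ) : ∃ z : Fin s → N k, ∀ i, f i k = ∑ l, r l i • z l := by
    obtain ⟨m, a, y, hay, ham⟩ := vanishesTrivially_of_sum_tmul_eq_zero R hx
      (n := fun i => f i k) (by simpa using ht k)
    have hmem (j : Fin m) : ∃ c : Fin s → R, ∑ l, c l • r l = fun i => a i j := by
      rw [← Submodule.mem_span_range_iff_exists_fun, hr]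
      simpa [Fintype.linearCombination_apply] using ham j
    choose c hc using hmem
    refine ⟨fun l => ∑ j, c j l • y j, fun i => ?_⟩
    simp only [show f i k = ∑ j, a i j • y j from hay i, Finset.smul_sum]
    rw [Finset.sum_comm]
    refine Finset.sum_congr rfl fun j _ => ?_
    rw [← congrFun (hc j) i]
    simp [Finset.sum_smul, smul_smul, mul_comm]
  choose z hz using key
  exact sum_tmul_eq_zero_of_vanishesTrivially R
    ⟨s, fun i l => r l i, fun l k => z k l, fun i => by ext k; simp [hz], hrel⟩

end Products

section CharacterModule

variable {R : Type u} [CommRing R]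

/-- The evaluation map from a module to its double character module. -/
noncomputable def CharacterModule.evalDual (R A : Type*) [CommRing R] [AddCommGroup A]
    [Module R A] : A →ₗ[R] CharacterModule (CharacterModule A) where
  toFun a :=
    { toFun := fun c => c a
      map_zero' := rfl
      map_add' := fun _ _ => rfl }
  map_add' a b := by ext c; exact map_add c a b
  map_smul' _ _ := rfl

lemma CharacterModule.isPureMono_evalDual (A : Type u) [AddCommGroup A] [Module R A] :
    IsPureMono R (CharacterModule.evalDual R A) := by
  refine .of_forall_lTensor fun X _ _ => (injective_iff_map_eq_zero _).mpr fun t ht => ?_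
  refine CharacterModule.eq_zero_of_character_apply fun c => ?_
  have hc (t : X ⊗[R] A) : CharacterModule.uncurry
      (CharacterModule.evalDual R (CharacterModule A) ∘ₗ CharacterModule.curry c)
        ((CharacterModule.evalDual R A).lTensor X t) = c t := by
    induction t with
    | zero => simp only [map_zero]
    | add a b ha hb => simp only [map_add, ha, hb]
    | tmul x a => rfl
  rw [← hc t, ht, map_zero]

/-- Maps into a character module extend along pure monomorphisms. -/
lemma IsPureMono.exists_extension_characterModule {A B Z : Type u} [AddCommGroup A] [Module R A]
    [AddCommGroup B] [Module R B] [AddCommGroup Z] [Module R Z] {f : A →ₗ[R] B}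
    (hf : IsPureMono R f) (g : A →ₗ[R] CharacterModule Z) :
    ∃ h : B →ₗ[R] CharacterModule Z, h ∘ₗ f = g := by
  refine rTensor_injective_iff_lcomp_surjective.mp ?_ g
  have := hf.2 Z
  rwa [LinearMap.lTensor_inj_iff_rTensor_inj] at this

end CharacterModule

section AdicHull

variable {R : Type u} [CommRing R]

/-- The product of the double character modules of the quotients `M / I ^ n M`. -/
abbrev AdicHull (I : Ideal R) (M : Type u) [AddCommGroup M] [Module R M] : Type u :=
  ∀ n : ℕ, CharacterModule (CharacterModule (M ⧸ (I ^ n • ⊤ : Submodule R M)))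

/-- The canonical map from a module to the product of the double character modules of its
quotients by the powers of `I`. -/
noncomputable def AdicHull.of (I : Ideal R) (M : Type u) [AddCommGroup M] [Module R M] :
    M →ₗ[R] AdicHull I M :=
  LinearMap.pi fun n => CharacterModule.evalDual R _ ∘ₗ (I ^ n • ⊤ : Submodule R M).mkQ

lemma IsPureMono.exists_extension_adicHull {I : Ideal R} {M A B : Type u} [AddCommGroup M]
    [Module R M] [AddCommGroup A] [Module R A] [AddCommGroup B] [Module R B] {f : A →ₗ[R] B}
    (hf : IsPureMono R f) (g : A →ₗ[R] AdicHull I M) :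
    ∃ h : B →ₗ[R] AdicHull I M, h ∘ₗ f = g := by
  choose h hh using fun n => hf.exists_extension_characterModule (LinearMap.proj n ∘ₗ g)
  refine ⟨LinearMap.pi h, ?_⟩
  ext a n : 2
  exact LinearMap.congr_fun (hh n) a

lemma mem_smul_top_of_lTensor_mkQ_eq_zero {I : Ideal R} {X M : Type*} [AddCommGroup X]
    [Module R X] [AddCommGroup M] [Module R M] {t : X ⊗[R] M}
    (ht : (I • ⊤ : Submodule R M).mkQ.lTensor X t = 0) :
    t ∈ I • (⊤ : Submodule R (X ⊗[R] M)) := by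
  obtain ⟨s, rfl⟩ := (lTensor_exact X (LinearMap.exact_subtype_mkQ (I • ⊤ : Submodule R M))
    (Submodule.mkQ_surjective _) t).mp ht
  clear ht
  induction s with
  | zero => simp
  | add a b ha hb =>
    rw [map_add]
    exact add_mem ha hb
  | tmul x m =>
    have hle : I • ⊤ ≤ (I • ⊤ : Submodule R (X ⊗[R] M)).comap (TensorProduct.mk R X M x) :=
      Submodule.smul_top_le_comap_smul_top _ _
    exact hle m.2

lemma AdicHull.isHausdorff_tensorProduct [IsNoetherianRing R] (I : Ideal R) (M X : Type u)
    [AddCommGroup M] [Module R M] [AddCommGroup X] [Module R X] [Module.Finite R X] :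
    IsHausdorff I (X ⊗[R] AdicHull I M) := by
  refine ⟨fun t ht => eq_zero_of_forall_lTensor_proj_eq_zero (κ := ℕ) t fun n => ?_⟩
  have hn := ht n
  rw [SModEq.zero] at hn
  have h0 : I ^ n • (⊤ : Submodule R (X ⊗[R] CharacterModule (CharacterModule
      (M ⧸ (I ^ n • ⊤ : Submodule R M))))) = ⊥ := by
    rw [eq_bot_iff, Submodule.smul_le]
    rintro r hr s -
    have hr0 (c : CharacterModule (CharacterModule (M ⧸ (I ^ n • ⊤ : Submodule R M)))) :
        r • c = 0 := by
      ext d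
      suffices r • d = 0 by rw [CharacterModule.smul_apply, this, map_zero]; rfl
      ext q
      obtain ⟨m, rfl⟩ := Submodule.mkQ_surjective _ q
      rw [CharacterModule.smul_apply, ← map_smul, Submodule.mkQ_apply,
        (Submodule.Quotient.mk_eq_zero _).mpr (Submodule.smul_mem_smul hr Submodule.mem_top),
        map_zero]
      rfl
    rw [Submodule.mem_bot]
    induction s with
    | zero => simp
    | add a b ha hb => rw [smul_add, ha, hb, add_zero]
    | tmul x c => rw [← TensorProduct.tmul_smul, hr0, TensorProduct.tmul_zero]
  rw [← Submodule.mem_bot R, ← h0]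
  exact Submodule.smul_top_le_comap_smul_top _ _ hn

end AdicHull

section TotallySeparated

variable {R : Type u} [CommRing R] [IsLocalRing R]

lemma IsTotallySeparatedModule.isPureMono_adicHull {M : Type u} [AddCommGroup M] [Module R M]
    (hM : IsTotallySeparatedModule R M) : IsPureMono R (AdicHull.of (maximalIdeal R) M) := by
  refine .of_forall_finite fun X _ _ _ => (injective_iff_map_eq_zero _).mpr fun t ht => ?_
  refine (hM X).haus t fun n => ?_
  rw [SModEq.zero]
  apply mem_smul_top_of_lTensor_mkQ_eq_zero
  apply (injective_iff_map_eq_zero _).mp ((CharacterModule.isPureMono_evalDual _).2 X)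
  rw [← LinearMap.comp_apply, ← LinearMap.lTensor_comp]
  have hproj : CharacterModule.evalDual R _ ∘ₗ (maximalIdeal R ^ n • ⊤ : Submodule R M).mkQ =
      LinearMap.proj n ∘ₗ AdicHull.of (maximalIdeal R) M := rfl
  rw [hproj, LinearMap.lTensor_comp, LinearMap.comp_apply, ht, map_zero]

lemma IsTotallySeparatedModule.of_isPureMono_adicHull [IsNoetherianRing R] {M Y : Type u}
    [AddCommGroup M] [Module R M] [AddCommGroup Y] [Module R Y]
    {f : Y →ₗ[R] AdicHull (maximalIdeal R) M} (hf : IsPureMono R f) :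
    IsTotallySeparatedModule R Y := by
  refine fun X _ _ _ => ⟨fun t ht => (injective_iff_map_eq_zero _).mp (hf.2 X) t ?_⟩
  refine (AdicHull.isHausdorff_tensorProduct (maximalIdeal R) M X).haus _ fun n => ?_
  rw [SModEq.zero]
  exact Submodule.smul_top_le_comap_smul_top _ (f.lTensor X) (SModEq.zero.mp (ht n))

end TotallySeparated

/-- (a) If `M` is totally separated and `M ⊆ Y` strictly pure-essential,
then `Y` is totally separated. (b) If `Y` is totally separated and `M` is pure and dense in
`Y`, then `M ⊆ Y` is strictly pure-essential. -/
theorem totallySeparated_strictlyPureEssential (R : Type u) [CommRing R] [IsNoetherianRing R]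
    [IsLocalRing R] (Y : Type u) [AddCommGroup Y] [Module R Y] (M : Submodule R Y) :
    (IsTotallySeparatedModule R M → IsStrictlyPureEssential R M →
        IsTotallySeparatedModule R Y) ∧
      (IsTotallySeparatedModule R Y → IsPureMono R M.subtype →
        M ⊔ maximalIdeal R • (⊤ : Submodule R Y) = ⊤ → IsStrictlyPureEssential R M) := by
  refine ⟨fun hM hMY => ?_, fun hY hM hd => ?_⟩
  · have hpure := hM.isPureMono_adicHull
    obtain ⟨g, hg⟩ := hMY.1.1.exists_extension_adicHull (AdicHull.of (maximalIdeal R) M)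
    rw [← hg] at hpure
    have hker : LinearMap.ker g = ⊥ := by
      refine hMY.1.2 _ ?_ ?_
      · rw [eq_bot_iff]
        rintro y ⟨hy, hyM⟩
        simpa using (injective_iff_map_eq_zero _).mp hpure.1 ⟨y, hyM⟩ hy
      · rw [← Submodule.liftQ_mkQ (LinearMap.ker g) g le_rfl, LinearMap.comp_assoc] at hpure
        exact hpure.of_comp
    exact .of_isPureMono_adicHull (hMY.2 _ g (LinearMap.ker_eq_bot.mp hker) hpure)
  · have hd' : M.subtype.range ⊔ maximalIdeal R • ⊤ = ⊤ := by rwa [Submodule.range_subtype]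
    refine ⟨⟨hM, fun X _ hX => ?_⟩, fun Z _ _ g _ hg => hY.isPureMono_of_dense hd' hg⟩
    rw [← X.ker_mkQ, LinearMap.ker_eq_bot]
    exact (hY.isPureMono_of_dense hd' hX).1
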